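/- If A is moreover a noetherian ring, then the Smith algebra S(A,f,n) has no zero divisors and is a left and right noetherian ring. -/

import Mathlib

namespace SmithAlgebraStmt

variable (A : Type*) [CommRing A]

/-- The generator `x` of the free algebra on three generators. -/
noncomputable def gX : FreeAlgebra A (Fin 3) := FreeAlgebra.ι A 0
/-- The generator `y` of the free algebra on three generators. -/
noncomputable def gY : FreeAlgebra A (Fin 3) := FreeAlgebra.ι A 1
/-- The generator `e` of the free algebra on three generators. -/
noncomputable def gE : FreeAlgebra A (Fin 3) := FreeAlgebra.ι A 2

/-- The defining relations of the Smith algebra `S(A,f,n)`: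
`e*x − x*e = n•x`, `e*y − y*e = −n•y`, `y*x − x*y = f(e)`. -/
inductive SmithRel (n : ℕ) (f : Polynomial A) :
    FreeAlgebra A (Fin 3) → FreeAlgebra A (Fin 3) → Prop
  | ex : SmithRel n f (gE A * gX A - gX A * gE A) (n • gX A)
  | ey : SmithRel n f (gE A * gY A - gY A * gE A) (-(n • gY A))
  | yx : SmithRel n f (gY A * gX A - gX A * gY A) (Polynomial.aeval (gE A) f)

/-- The Smith algebra `S(A,f,n)`: the quotient of the free `A`-algebra on three
generators `x, y, e` by the two-sided ideal generated by the elements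
`e*x − x*e − n•x`, `e*y − y*e + n•y` and `y*x − x*y − f(e)`. -/
abbrev Smith (n : ℕ) (f : Polynomial A) := RingQuot (SmithRel A n f)

/-- The image of `x` in the Smith algebra. -/
noncomputable def x (n : ℕ) (f : Polynomial A) : Smith A n f :=
  RingQuot.mkAlgHom A (SmithRel A n f) (gX A)
/-- The image of `y` in the Smith algebra. -/
noncomputable def y (n : ℕ) (f : Polynomial A) : Smith A n f :=
  RingQuot.mkAlgHom A (SmithRel A n f) (gY A)
/-- The image of `e` in the Smith algebra. -/
noncomputable def e (n : ℕ) (f : Polynomial A) : Smith A n f :=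
  RingQuot.mkAlgHom A (SmithRel A n f) (gE A)

open Polynomial

section
variable {R S : Type*} [Ring R] [Ring S] [Module R S] [IsScalarTower R S S]

/-- The left `R`-submodule spanned by the powers of `z` with exponent less than `m`. -/
def powersLT (R : Type*) {S : Type*} [Ring R] [Ring S] [Module R S] (z : S) (m : ℕ) :
    Submodule R S :=
  Submodule.span R ((fun k => z ^ k) '' Set.Iio m)

omit [IsScalarTower R S S] in
theorem powersLT_mono (z : S) : Monotone (powersLT R z) := fun _ _ h =>
  Submodule.span_mono (Set.image_mono (Set.Iio_subset_Iio h))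

omit [IsScalarTower R S S] in
theorem pow_mem_powersLT (z : S) {k m : ℕ} (h : k < m) : z ^ k ∈ powersLT R z m :=
  Submodule.subset_span ⟨k, h, rfl⟩

omit [IsScalarTower R S S] in
theorem mem_powersLT_succ {z : S} {m : ℕ} {p : S} (hp : p ∈ powersLT R z (m + 1)) :
    ∃ (r : R), p - r • z ^ m ∈ powersLT R z m := by
  induction hp using Submodule.span_induction with
  | mem p hp =>
    obtain ⟨k, hk, rfl⟩ := hp
    rcases (Nat.lt_succ_iff.1 hk).lt_or_eq with h | rfl
    · exact ⟨0, by simpa using pow_mem_powersLT z h⟩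
    · exact ⟨1, by simp⟩
  | zero => exact ⟨0, by simp⟩
  | add p q _ _ hp hq =>
    obtain ⟨r, hr⟩ := hp
    obtain ⟨s, hs⟩ := hq
    refine ⟨r + s, ?_⟩
    convert add_mem hr hs using 1
    rw [add_smul]; abel
  | smul a p _ hp =>
    obtain ⟨r, hr⟩ := hp
    refine ⟨a * r, ?_⟩
    rw [mul_smul, ← smul_sub]
    exact Submodule.smul_mem _ _ hr

section
variable {z : S} (h₁ : ∀ r : R, ∃ r' r'' : R, z * r • (1 : S) = r' • z + r'' • (1 : S))

include h₁ in
theorem mul_mem_powersLT_succ {m : ℕ} {p : S} (hp : p ∈ powersLT R z m) :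
    z * p ∈ powersLT R z (m + 1) := by
  induction hp using Submodule.span_induction with
  | mem p hp =>
    obtain ⟨k, hk, rfl⟩ := hp
    change z * z ^ k ∈ _
    rw [← pow_succ']
    exact pow_mem_powersLT z (Nat.succ_lt_succ hk)
  | zero => simp
  | add p q _ _ hp hq => rw [mul_add]; exact add_mem hp hq
  | smul a p h hp =>
    obtain ⟨r', r'', h'⟩ := h₁ a
    have : z * a • p = r' • (z * p) + r'' • p := by
      rw [← smul_one_mul a p, ← mul_assoc, h', add_mul, smul_mul_assoc, smul_mul_assoc, one_mul]
    rw [this]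
    exact add_mem (Submodule.smul_mem _ _ hp)
      (Submodule.smul_mem _ _ (powersLT_mono z m.le_succ h))

include h₁ in
theorem pow_mul_mem_powersLT {m : ℕ} {p : S} (k : ℕ) (hp : p ∈ powersLT R z m) :
    z ^ k * p ∈ powersLT R z (m + k) := by
  induction k with
  | zero => simpa using hp
  | succ k ih => rw [pow_succ', mul_assoc]; exact mul_mem_powersLT_succ h₁ ih

include h₁ in
theorem exists_smul_pow_sub_pow_mul_mem (m : ℕ) (r : R) :
    ∃ r' : R, r' • z ^ m - z ^ m * r • (1 : S) ∈ powersLT R z m := by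
  induction m with
  | zero => exact ⟨r, by simp⟩
  | succ m ih =>
    obtain ⟨s, hs⟩ := ih
    obtain ⟨s', s'', h⟩ := h₁ s
    refine ⟨s', ?_⟩
    have e : s' • z ^ (m + 1) - z ^ (m + 1) * r • (1 : S) =
        z * (s • z ^ m - z ^ m * r • (1 : S)) - s'' • z ^ m := by
      rw [mul_sub, ← smul_one_mul s (z ^ m), ← mul_assoc, h, add_mul, smul_mul_assoc,
        smul_one_mul, ← pow_succ', ← mul_assoc, ← pow_succ']
      abel
    rw [e]
    exact sub_mem (mul_mem_powersLT_succ h₁ hs)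
      (Submodule.smul_mem _ _ (pow_mem_powersLT z m.lt_succ_self))

variable (h₂ : ∀ r : R, ∃ r' r'' : R, r • z = z * r' • (1 : S) + r'' • (1 : S))

include h₁ h₂ in
theorem exists_smul_pow_sub_pow_mul_mem' (m : ℕ) (r : R) :
    ∃ r' : R, r • z ^ m - z ^ m * r' • (1 : S) ∈ powersLT R z m := by
  induction m generalizing r with
  | zero => exact ⟨r, by simp⟩
  | succ m ih =>
    obtain ⟨s', s'', h⟩ := h₂ r
    obtain ⟨t, ht⟩ := ih s'
    refine ⟨t, ?_⟩
    have e : r • z ^ (m + 1) - z ^ (m + 1) * t • (1 : S) =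
        z * (s' • z ^ m - z ^ m * t • (1 : S)) + s'' • z ^ m := by
      rw [mul_sub, ← smul_one_mul s' (z ^ m), ← mul_assoc, ← mul_assoc, ← pow_succ', pow_succ',
        ← smul_mul_assoc, h, add_mul, smul_one_mul]
      abel
    rw [e]
    exact add_mem (mul_mem_powersLT_succ h₁ ht)
      (Submodule.smul_mem _ _ (pow_mem_powersLT z m.lt_succ_self))

include h₁ in
theorem mul_smul_one_mem_powersLT {m : ℕ} {p : S} (hp : p ∈ powersLT R z m) (r : R) :
    p * r • (1 : S) ∈ powersLT R z m := by
  induction hp using Submodule.span_induction with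
  | mem p hp =>
    obtain ⟨k, hk, rfl⟩ := hp
    have h : r • (1 : S) ∈ powersLT R z 1 := by
      simpa using Submodule.smul_mem _ r (pow_mem_powersLT (R := R) z zero_lt_one)
    refine powersLT_mono z ?_ (pow_mul_mem_powersLT h₁ k h)
    have : k < m := hk
    omega
  | zero => simp
  | add p q _ _ hp hq => rw [add_mul]; exact add_mem hp hq
  | smul a p _ hp => rw [smul_mul_assoc]; exact Submodule.smul_mem _ _ hp

/-- The left ideal of leading coefficients `r` of elements `z ^ m * r + (lower terms)` of `I`. -/
def leadingCoeffIdeal (I : Ideal S) (m : ℕ) : Ideal R where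
  carrier := {r | ∃ s ∈ powersLT R z m, z ^ m * r • (1 : S) + s ∈ I}
  zero_mem' := ⟨0, zero_mem _, by simp⟩
  add_mem' := by
    rintro a b ⟨s, hs, hs'⟩ ⟨t, ht, ht'⟩
    refine ⟨s + t, add_mem hs ht, ?_⟩
    convert add_mem hs' ht' using 1
    rw [add_smul, mul_add]; abel
  smul_mem' := by
    rintro a b ⟨s, hs, hs'⟩
    obtain ⟨c, hc⟩ := exists_smul_pow_sub_pow_mul_mem h₁ m a
    refine ⟨(c • z ^ m - z ^ m * a • (1 : S)) * b • (1 : S) + c • s,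
      add_mem (mul_smul_one_mem_powersLT h₁ hc b) (Submodule.smul_mem _ _ hs), ?_⟩
    convert I.mul_mem_left (c • 1) hs' using 1
    rw [smul_one_mul, smul_add, sub_mul, smul_mul_assoc c, smul_eq_mul, mul_smul, mul_assoc,
      smul_one_mul a]
    abel

theorem leadingCoeffIdeal_mono (I : Ideal S) : Monotone (leadingCoeffIdeal h₁ I) := by
  refine monotone_nat_of_le_succ fun m r hr => ?_
  obtain ⟨s, hs, hs'⟩ := hr
  refine ⟨z * s, mul_mem_powersLT_succ h₁ hs, ?_⟩
  rw [pow_succ', mul_assoc, ← mul_add]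
  exact I.mul_mem_left _ hs'

include h₁ h₂ in
/-- A form of the Hilbert basis theorem: if `S` is generated as a left module over the left
noetherian ring `R` by the powers of an element `z` such that `z R ⊆ R z + R` and
`R z ⊆ z R + R`, then `S` is left noetherian. -/
theorem isNoetherianRing_of_powers [IsNoetherianRing R]
    (hz : ∀ s : S, ∃ m, s ∈ powersLT R z m) : IsNoetherianRing S := by
  rw [isNoetherianRing_iff_ideal_fg]
  intro I
  obtain ⟨N, hN⟩ := monotone_stabilizes_iff_noetherian.mpr ‹IsNoetherianRing R›
    ⟨leadingCoeffIdeal h₁ I, leadingCoeffIdeal_mono h₁ I⟩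
  replace hN : ∀ m, N ≤ m → leadingCoeffIdeal h₁ I N = leadingCoeffIdeal h₁ I m := hN
  let J : Submodule R S := I.restrictScalars R ⊓ powersLT R z (N + 1)
  have hfin : (powersLT R z (N + 1)).FG :=
    Submodule.fg_span ((Set.finite_Iio _).image _)
  have : IsNoetherian R (powersLT R z (N + 1)) := isNoetherian_of_fg_of_noetherian _ hfin
  obtain ⟨t, ht⟩ : J.FG := isNoetherian_submodule.mp this J inf_le_right
  refine ⟨t, le_antisymm (Submodule.span_le.2 fun p hp => ?_) ?_⟩
  · exact (ht ▸ Submodule.subset_span hp : p ∈ J).1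
  have hJ : ∀ p ∈ J, p ∈ Ideal.span (t : Set S) := by
    intro p hp
    rw [← ht] at hp
    exact Submodule.span_le_restrictScalars R S _ hp
  have key : ∀ m, ∀ p ∈ I, p ∈ powersLT R z m → p ∈ Ideal.span (t : Set S) := by
    intro m
    induction m with
    | zero => intro p hpI hp; exact hJ p ⟨hpI, powersLT_mono z (Nat.zero_le _) hp⟩
    | succ m ih =>
      intro p hpI hp
      rcases le_or_gt m N with h | h
      · exact hJ p ⟨hpI, powersLT_mono z (by omega) hp⟩
      obtain ⟨r, hr⟩ := mem_powersLT_succ hp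
      obtain ⟨r', hr'⟩ := exists_smul_pow_sub_pow_mul_mem' h₁ h₂ m r
      have hlead : r' ∈ leadingCoeffIdeal h₁ I m :=
        ⟨_, add_mem hr hr', by convert hpI using 1; abel⟩
      rw [← hN m h.le] at hlead
      obtain ⟨s, hs, hs'⟩ := hlead
      have hq : z ^ N * r' • (1 : S) + s ∈ Ideal.span (t : Set S) := by
        refine hJ _ ⟨hs', add_mem ?_ (powersLT_mono z N.le_succ hs)⟩
        exact mul_smul_one_mem_powersLT h₁ (pow_mem_powersLT z N.lt_succ_self) r'
      have hq' := Ideal.mul_mem_left (Ideal.span (t : Set S)) (z ^ (m - N)) hq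
      have hsplit : p - z ^ (m - N) * (z ^ N * r' • (1 : S) + s) =
          (p - r • z ^ m) + (r • z ^ m - z ^ m * r' • (1 : S)) - z ^ (m - N) * s := by
        rw [mul_add, ← mul_assoc, ← pow_add, Nat.sub_add_cancel h.le]; abel
      have hrec := ih (p - z ^ (m - N) * (z ^ N * r' • (1 : S) + s))
        (sub_mem hpI (I.mul_mem_left _ hs')) (by
          rw [hsplit]
          refine sub_mem (add_mem hr hr') ?_
          have := pow_mul_mem_powersLT h₁ (m - N) hs
          rwa [Nat.add_sub_cancel' h.le] at this)
      simpa using add_mem hrec hq'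
  intro p hp
  obtain ⟨m, hm⟩ := hz p
  exact key m p hp hm
end
end

/-- A form of the Hilbert basis theorem: if `S` is generated as a ring by the image of a left
noetherian ring `R` and an element `z` such that `z R ⊆ R z + R` and `R z ⊆ z R + R`, then `S` is
left noetherian. -/
theorem isNoetherianRing_of_closure_eq_top {R S : Type*} [Ring R] [Ring S] [IsNoetherianRing R]
    (i : R →+* S) (z : S)
    (h₁ : ∀ r, ∃ r' r'', z * i r = i r' * z + i r'')
    (h₂ : ∀ r, ∃ r' r'', i r * z = z * i r' + i r'')
    (hz : Subring.closure (insert z (Set.range i)) = ⊤) : IsNoetherianRing S := by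
  let : Module R S := Module.compHom S i
  have smul_def : ∀ (r : R) (s : S), r • s = i r * s := fun _ _ => rfl
  have : IsScalarTower R S S := ⟨fun r s t => by simp [smul_def, mul_assoc]⟩
  have h₁' : ∀ r : R, ∃ r' r'' : R, z * r • (1 : S) = r' • z + r'' • (1 : S) := by
    simpa [smul_def] using h₁
  refine isNoetherianRing_of_powers h₁' (by simpa [smul_def] using h₂) fun s => ?_
  have hs : s ∈ Subring.closure (insert z (Set.range i)) := hz ▸ Subring.mem_top s
  suffices h : ∀ m, ∀ t ∈ powersLT R z m, ∃ m', s * t ∈ powersLT R z m' by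
    simpa using h 1 1 (by simpa using pow_mem_powersLT (R := R) z zero_lt_one)
  induction hs using Subring.closure_induction with
  | mem s hs =>
    intro m t ht
    rcases hs with rfl | ⟨r, rfl⟩
    · exact ⟨_, mul_mem_powersLT_succ h₁' ht⟩
    · exact ⟨m, Submodule.smul_mem _ r ht⟩
  | zero => exact fun m t _ => ⟨0, by simp⟩
  | one => exact fun m t ht => ⟨m, by simpa using ht⟩
  | add s s' _ _ hs hs' =>
    intro m t ht
    obtain ⟨k, hk⟩ := hs m t ht
    obtain ⟨k', hk'⟩ := hs' m t ht
    rw [add_mul]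
    exact ⟨max k k', add_mem (powersLT_mono z (le_max_left _ _) hk)
      (powersLT_mono z (le_max_right _ _) hk')⟩
  | neg s _ hs =>
    intro m t ht
    obtain ⟨k, hk⟩ := hs m t ht
    exact ⟨k, by simpa using hk⟩
  | mul s s' _ _ hs hs' =>
    intro m t ht
    obtain ⟨k, hk⟩ := hs' m t ht
    rw [mul_assoc]
    exact hs k _ hk

/-- Moving `z` to the right past a subring can be checked on generators. -/
theorem exists_mul_eq_of_mem_closure {S : Type*} [Ring S] {G : Set S} {z : S}
    (h : ∀ g ∈ G, ∃ r' ∈ Subring.closure G, ∃ r'' ∈ Subring.closure G, z * g = r' * z + r'')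
    {r : S} (hr : r ∈ Subring.closure G) :
    ∃ r' ∈ Subring.closure G, ∃ r'' ∈ Subring.closure G, z * r = r' * z + r'' := by
  induction hr using Subring.closure_induction with
  | mem g hg => exact h g hg
  | zero => exact ⟨0, zero_mem _, 0, zero_mem _, by simp⟩
  | one => exact ⟨1, one_mem _, 0, zero_mem _, by simp⟩
  | add a b _ _ ha hb =>
    obtain ⟨a', ha', a'', ha'', ea⟩ := ha
    obtain ⟨b', hb', b'', hb'', eb⟩ := hb
    exact ⟨a' + b', add_mem ha' hb', a'' + b'', add_mem ha'' hb'', by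
      rw [mul_add, ea, eb]; noncomm_ring⟩
  | neg a _ ha =>
    obtain ⟨a', ha', a'', ha'', ea⟩ := ha
    exact ⟨-a', neg_mem ha', -a'', neg_mem ha'', by rw [mul_neg, ea]; noncomm_ring⟩
  | mul a b _ hb₀ ha hb =>
    obtain ⟨a', ha', a'', ha'', ea⟩ := ha
    obtain ⟨b', hb', b'', hb'', eb⟩ := hb
    refine ⟨a' * b', mul_mem ha' hb', a' * b'' + a'' * b,
      add_mem (mul_mem ha' hb'') (mul_mem ha'' hb₀), ?_⟩
    rw [← mul_assoc, ea, add_mul, mul_assoc, eb]; noncomm_ring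

/-- Moving `z` to the left past a subring can be checked on generators. -/
theorem exists_mul_eq_of_mem_closure' {S : Type*} [Ring S] {G : Set S} {z : S}
    (h : ∀ g ∈ G, ∃ r' ∈ Subring.closure G, ∃ r'' ∈ Subring.closure G, g * z = z * r' + r'')
    {r : S} (hr : r ∈ Subring.closure G) :
    ∃ r' ∈ Subring.closure G, ∃ r'' ∈ Subring.closure G, r * z = z * r' + r'' := by
  induction hr using Subring.closure_induction with
  | mem g hg => exact h g hg
  | zero => exact ⟨0, zero_mem _, 0, zero_mem _, by simp⟩
  | one => exact ⟨1, one_mem _, 0, zero_mem _, by simp⟩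
  | add a b _ _ ha hb =>
    obtain ⟨a', ha', a'', ha'', ea⟩ := ha
    obtain ⟨b', hb', b'', hb'', eb⟩ := hb
    exact ⟨a' + b', add_mem ha' hb', a'' + b'', add_mem ha'' hb'', by
      rw [add_mul, ea, eb]; noncomm_ring⟩
  | neg a _ ha =>
    obtain ⟨a', ha', a'', ha'', ea⟩ := ha
    exact ⟨-a', neg_mem ha', -a'', neg_mem ha'', by rw [neg_mul, ea]; noncomm_ring⟩
  | mul a b ha₀ _ ha hb =>
    obtain ⟨a', ha', a'', ha'', ea⟩ := ha
    obtain ⟨b', hb', b'', hb'', eb⟩ := hb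
    refine ⟨a' * b', mul_mem ha' hb', a'' * b' + a * b'',
      add_mem (mul_mem ha'' hb') (mul_mem ha₀ hb''), ?_⟩
    rw [mul_assoc, eb, mul_add, ← mul_assoc, ea]; noncomm_ring

/-- If `z * e = (e + c) * z`, then `z * p(e) = p(e + c) * z` for every polynomial `p`. -/
theorem mul_aeval_eq_of_mul_eq {A S : Type*} [CommRing A] [Ring S] [Algebra A S] {z e : S} {c : A}
    (h : z * e = (e + algebraMap A S c) * z) (p : A[X]) :
    z * aeval e p = aeval e (p.comp (X + C c)) * z := by
  induction p using Polynomial.induction_on' with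
  | add p q hp hq => simp [mul_add, add_mul, hp, hq]
  | monomial k a =>
    have hk : SemiconjBy z (e ^ k) ((e + algebraMap A S c) ^ k) :=
      SemiconjBy.pow_right h k
    simp only [aeval_monomial, monomial_comp, map_mul, map_pow, map_add, aeval_C, aeval_X]
    rw [← mul_assoc, ← Algebra.commutes a z, mul_assoc, hk.eq, mul_assoc]

/-- If `e * z = z * (e + c)`, then `p(e) * z = z * p(e + c)` for every polynomial `p`. -/
theorem aeval_mul_eq_of_mul_eq {A S : Type*} [CommRing A] [Ring S] [Algebra A S] {z e : S} {c : A}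
    (h : e * z = z * (e + algebraMap A S c)) (p : A[X]) :
    aeval e p * z = z * aeval e (p.comp (X + C c)) := by
  induction p using Polynomial.induction_on' with
  | add p q hp hq => simp [mul_add, add_mul, hp, hq]
  | monomial k a =>
    have hk : SemiconjBy z ((e + algebraMap A S c) ^ k) (e ^ k) :=
      SemiconjBy.pow_right h.symm k
    simp only [aeval_monomial, monomial_comp, map_mul, map_pow, map_add, aeval_C, aeval_X]
    rw [mul_assoc, ← hk.eq, ← mul_assoc, Algebra.commutes a z, mul_assoc]

section
variable {A S : Type*} [CommRing A] [Ring S] [Algebra A S] {n : ℕ} {x y e : S}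

theorem mul_eq_mul_add_of_relation (hx : e * x - x * e = n • x) :
    e * x = x * (e + algebraMap A S n) := by
  rw [mul_add, map_natCast, ← nsmul_eq_mul', ← hx]; abel

theorem mul_eq_add_mul_of_relation (hy : e * y - y * e = -(n • y)) :
    y * e = (e + algebraMap A S n) * y := by
  rw [add_mul, map_natCast, ← nsmul_eq_mul, ← neg_neg (n • y), ← hy]; abel
end

/-- An algebra over a noetherian ring generated by elements satisfying the relations of a
Smith algebra is left noetherian. -/
theorem isNoetherianRing_of_smith_relations {A S : Type*} [CommRing A] [IsNoetherianRing A]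
    [Ring S] [Algebra A S] {n : ℕ} {f : A[X]} {x y e : S}
    (hx : e * x - x * e = n • x) (hy : e * y - y * e = -(n • y))
    (hyx : y * x - x * y = aeval e f) (hgen : Algebra.adjoin A {x, y, e} = ⊤) :
    IsNoetherianRing S := by
  have hex : e * x = x * (e + algebraMap A S n) := mul_eq_mul_add_of_relation hx
  have hxe : x * e = (e + algebraMap A S (-n)) * x := by
    rw [add_mul, map_neg, map_natCast, neg_mul, ← nsmul_eq_mul, ← hx]; abel
  have hye : y * e = (e + algebraMap A S n) * y := mul_eq_add_mul_of_relation hy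
  have hey : e * y = y * (e + algebraMap A S (-n)) := by
    rw [mul_add, map_neg, map_natCast, mul_neg, ← nsmul_eq_mul', ← hy]; abel
  let G : Set S := insert x (Set.range (aeval (R := A) e))
  let B := Subring.closure G
  have hxB : x ∈ B := Subring.subset_closure (Set.mem_insert _ _)
  have hpB (p : A[X]) : aeval e p ∈ B :=
    Subring.subset_closure (Set.mem_insert_of_mem _ ⟨p, rfl⟩)
  let i : A[X] →+* B := (aeval (R := A) e : A[X] →+* S).codRestrict B hpB
  have : IsNoetherianRing B := by
    refine isNoetherianRing_of_closure_eq_top i ⟨x, hxB⟩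
      (fun p => ⟨p.comp (X + C (-n : A)), 0, ?_⟩)
      (fun p => ⟨p.comp (X + C (n : A)), 0, ?_⟩) ?_
    · rw [map_zero, add_zero]
      exact Subtype.ext (mul_aeval_eq_of_mul_eq hxe p)
    · rw [map_zero, add_zero]
      exact Subtype.ext (aeval_mul_eq_of_mul_eq hex p)
    · refine eq_top_iff.2 fun ⟨b, hb⟩ _ => ?_
      induction hb using Subring.closure_induction with
      | mem g hg =>
        rcases hg with rfl | ⟨p, rfl⟩
        · exact Subring.subset_closure (Set.mem_insert _ _)
        · exact Subring.subset_closure (Set.mem_insert_of_mem _ ⟨p, rfl⟩)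
      | zero => exact zero_mem _
      | one => exact one_mem _
      | add a b _ _ ha hb => exact add_mem (ha trivial) (hb trivial)
      | neg a _ ha => exact neg_mem (ha trivial)
      | mul a b _ _ ha hb => exact mul_mem (ha trivial) (hb trivial)
  refine isNoetherianRing_of_closure_eq_top B.subtype y ?_ ?_ ?_
  · intro r
    obtain ⟨r', hr', r'', hr'', h⟩ := exists_mul_eq_of_mem_closure (z := y) (G := G) (by
      rintro g (rfl | ⟨p, rfl⟩)
      · exact ⟨_, hxB, _, hpB f, by rw [← hyx]; abel⟩
      · exact ⟨_, hpB _, 0, zero_mem _, by rw [add_zero]; exact mul_aeval_eq_of_mul_eq hye p⟩) r.2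
    exact ⟨⟨r', hr'⟩, ⟨r'', hr''⟩, h⟩
  · intro r
    obtain ⟨r', hr', r'', hr'', h⟩ := exists_mul_eq_of_mem_closure' (z := y) (G := G) (by
      rintro g (rfl | ⟨p, rfl⟩)
      · exact ⟨_, hxB, _, neg_mem (hpB f), by rw [← hyx]; abel⟩
      · exact ⟨_, hpB _, 0, zero_mem _, by rw [add_zero]; exact aeval_mul_eq_of_mul_eq hey p⟩) r.2
    exact ⟨⟨r', hr'⟩, ⟨r'', hr''⟩, h⟩
  · have hB : ∀ b ∈ B, b ∈ Subring.closure (insert y (Set.range B.subtype)) := fun b hb =>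
      Subring.subset_closure (Set.mem_insert_of_mem _ ⟨⟨b, hb⟩, rfl⟩)
    refine eq_top_iff.2 fun s _ => ?_
    have hs : s ∈ Algebra.adjoin A {x, y, e} := hgen ▸ Algebra.mem_top
    induction hs using Algebra.adjoin_induction with
    | mem s hs =>
      rcases hs with rfl | rfl | rfl
      · exact hB _ hxB
      · exact Subring.subset_closure (Set.mem_insert _ _)
      · exact hB _ (by simpa using hpB X)
    | algebraMap a => exact hB _ (by simpa using hpB (C a))
    | add s t _ _ hs ht => exact add_mem (hs trivial) (ht trivial)
    | mul s t _ _ hs ht => exact mul_mem (hs trivial) (ht trivial)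

open SkewMonoidAlgebra in
theorem coeff_mul_of_uniqueMul {R G : Type*} [Semiring R] [Group G]
    [MulSemiringAction G R] {a b : SkewMonoidAlgebra R G} {g h : G}
    (H : UniqueMul a.support b.support g h) :
    (a * b).coeff (g * h) = a.coeff g * g • b.coeff h := by
  rw [coeff_mul_left, sum_def', Finset.sum_eq_single g]
  · rw [inv_mul_cancel_left]
  · intro k hk hne
    by_contra hb
    refine hne (H hk (?_ : k⁻¹ * (g * h) ∈ b.support) (mul_inv_cancel_left _ _)).1
    rw [SkewMonoidAlgebra.mem_support_iff]
    intro h0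
    exact hb (by rw [h0, smul_zero, mul_zero])
  · intro hg
    rw [notMem_support_iff.1 hg, zero_mul]

open SkewMonoidAlgebra in
instance skewMonoidAlgebra_noZeroDivisors {R G : Type*} [Semiring R] [NoZeroDivisors R]
    [Group G] [UniqueProds G] [MulSemiringAction G R] :
    NoZeroDivisors (SkewMonoidAlgebra R G) where
  eq_zero_or_eq_zero_of_mul_eq_zero {a b} hab := by
    contrapose! hab
    obtain ⟨g, hg, h, hh, H⟩ := UniqueProds.uniqueMul_of_nonempty
      (Finset.nonempty_iff_ne_empty.2 (mt SkewMonoidAlgebra.support_eq_empty.1 hab.1))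
      (Finset.nonempty_iff_ne_empty.2 (mt SkewMonoidAlgebra.support_eq_empty.1 hab.2))
    rw [SkewMonoidAlgebra.mem_support_iff] at hg hh
    intro h0
    have := coeff_mul_of_uniqueMul H
    rw [h0, SkewMonoidAlgebra.coeff_zero, Finsupp.zero_apply] at this
    exact mul_ne_zero hg ((smul_ne_zero_iff_ne g).2 hh) this.symm

/-- The automorphism `e ↦ e + n`, `w ↦ w + f(e)` of the polynomial ring `A[e][w]`. -/
noncomputable def smithShift {A : Type*} [CommRing A] (n : ℕ) (f : A[X]) : A[X][X] ≃ₐ[A] A[X][X] :=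
  (mapAlgEquiv (algEquivAevalXAddC (n : A))).trans ((algEquivAevalXAddC f).restrictScalars A)

section
variable {A : Type*} [CommRing A] (n : ℕ) (f : A[X])

theorem smithShift_C (p : A[X]) : smithShift n f (C p) = C (p.comp (X + C (n : A))) := by
  simp [smithShift, aeval_def, comp, eval₂_eq_eval_map]

theorem smithShift_X : smithShift n f X = X + C f := by
  simp [smithShift]
end

/-- A ring homomorphism identity of the form `z * g p = h p * z` on `A[e][w]` may be checked on
`A[e]` and on `w`. -/
theorem semiconjBy_polynomial {R S : Type*} [Semiring R] [Semiring S] {g h : R[X] →+* S} {z : S}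
    (hC : ∀ r, SemiconjBy z (g (C r)) (h (C r))) (hX : SemiconjBy z (g X) (h X)) (p : R[X]) :
    SemiconjBy z (g p) (h p) := by
  induction p using Polynomial.induction_on' with
  | add p q hp hq => rw [map_add, map_add]; exact hp.add_right hq
  | monomial k r =>
    rw [← C_mul_X_pow_eq_monomial, map_mul, map_mul, map_pow, map_pow]
    exact (hC r).mul_right (hX.pow_right k)

/-- In an algebra satisfying the relations of a Smith algebra, `e` and `w = x * y` commute, which
gives a homomorphism from `A[e][w]`. -/
noncomputable def smithEval {A S : Type*} [CommRing A] [Ring S] [Algebra A S] {n : ℕ} {x y e : S}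
    (hx : e * x - x * e = n • x) (hy : e * y - y * e = -(n • y)) : A[X][X] →+* S :=
  eval₂RingHom' (aeval (R := A) e : A[X] →+* S) (x * y) fun p => by
    have h₁ := aeval_mul_eq_of_mul_eq (mul_eq_mul_add_of_relation (A := A) hx) p
    have h₂ := mul_aeval_eq_of_mul_eq (mul_eq_add_mul_of_relation (A := A) hy) p
    change aeval e p * (x * y) = x * y * aeval e p
    rw [← mul_assoc, h₁, mul_assoc, mul_assoc, h₂]

section
variable {A S : Type*} [CommRing A] [Ring S] [Algebra A S] {n : ℕ} {f : A[X]} {x y e : S}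
  (hx : e * x - x * e = n • x) (hy : e * y - y * e = -(n • y))

theorem smithEval_C (p : A[X]) : smithEval hx hy (C p) = aeval e p := eval₂_C _ _

theorem smithEval_X : smithEval (A := A) hx hy X = x * y := eval₂_X _ _

variable (hyx : y * x - x * y = aeval e f)

include hyx in
theorem smithEval_X_add_C : smithEval hx hy (X + C f) = y * x := by
  rw [map_add, smithEval_C, smithEval_X, ← hyx]; abel

include hyx in
theorem semiconjBy_y_smithEval (p : A[X][X]) :
    SemiconjBy y (smithEval hx hy p) (smithEval hx hy (smithShift n f p)) := by
  refine semiconjBy_polynomial (g := smithEval hx hy)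
    (h := (smithEval hx hy).comp (smithShift n f : A[X][X] →+* A[X][X])) (fun r => ?_) ?_ p
  · simp only [RingHom.comp_apply, RingHom.coe_coe, smithShift_C, smithEval_C]
    exact mul_aeval_eq_of_mul_eq (mul_eq_add_mul_of_relation hy) r
  · simp only [RingHom.comp_apply, RingHom.coe_coe, smithShift_X, smithEval_X_add_C hx hy hyx,
      smithEval_X]
    exact (mul_assoc _ _ _).symm

include hyx in
theorem semiconjBy_x_smithEval (p : A[X][X]) :
    SemiconjBy x (smithEval hx hy (smithShift n f p)) (smithEval hx hy p) := by
  refine semiconjBy_polynomial (h := smithEval hx hy)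
    (g := (smithEval hx hy).comp (smithShift n f : A[X][X] →+* A[X][X])) (fun r => ?_) ?_ p
  · simp only [RingHom.comp_apply, RingHom.coe_coe, smithShift_C, smithEval_C]
    exact (aeval_mul_eq_of_mul_eq (mul_eq_mul_add_of_relation hx) r).symm
  · simp only [RingHom.comp_apply, RingHom.coe_coe, smithShift_X, smithEval_X_add_C hx hy hyx,
      smithEval_X]
    exact (mul_assoc _ _ _).symm

/-- The element `y ^ k` for `k ≥ 0`, and `x ^ (-k)` for `k ≤ 0`. -/
def weightElement (x y : S) : ℤ → S
  | Int.ofNat k => y ^ k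
  | Int.negSucc k => x ^ (k + 1)

include hyx in
theorem exists_y_mul_weightElement (k : ℤ) :
    ∃ q, y * weightElement x y k = smithEval (A := A) hx hy q * weightElement x y (k + 1) := by
  rcases k with k | k
  · exact ⟨1, by rw [map_one, one_mul]; exact (pow_succ' y k).symm⟩
  · refine ⟨X + C f, ?_⟩
    rw [smithEval_X_add_C hx hy hyx, show Int.negSucc k + 1 = -(k : ℤ) by omega]
    rcases k with - | k
    · simp [weightElement]
    · change y * x ^ (k + 1 + 1) = y * x * x ^ (k + 1)
      rw [pow_succ' x (k + 1), mul_assoc]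

theorem exists_x_mul_weightElement (k : ℤ) :
    ∃ q, x * weightElement x y k = smithEval (A := A) hx hy q * weightElement x y (k - 1) := by
  rcases k with k | k
  · rcases k with - | k
    · refine ⟨1, ?_⟩
      change x * y ^ 0 = _ * x ^ (0 + 1)
      simp
    · refine ⟨X, ?_⟩
      rw [smithEval_X, show Int.ofNat (k + 1) - 1 = Int.ofNat k by simp]
      change x * y ^ (k + 1) = x * y * y ^ k
      rw [pow_succ' y k, mul_assoc]
  · refine ⟨1, ?_⟩
    rw [map_one, one_mul, show Int.negSucc k - 1 = Int.negSucc (k + 1) by omega]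
    exact (pow_succ' x (k + 1)).symm

/-- The additive map sending `∑ pₖ T ^ k` to `∑ pₖ(e, x * y) * uₖ`, with `uₖ` the element of
weight `k`. -/
noncomputable def weightSum : (ℤ →₀ A[X][X]) →+ S :=
  Finsupp.liftAddHom fun k =>
    (AddMonoidHom.mulRight (weightElement x y k)).comp (smithEval (A := A) hx hy).toAddMonoidHom

theorem weightSum_single (k : ℤ) (p : A[X][X]) :
    weightSum hx hy (Finsupp.single k p) = smithEval hx hy p * weightElement x y k := by
  simp [weightSum]

include hyx in
theorem weightSum_surjective (hgen : Algebra.adjoin A {x, y, e} = ⊤) :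
    Function.Surjective (weightSum (A := A) hx hy) := by
  set T := AddMonoidHom.mrange (weightSum (A := A) hx hy)
  have mem_T (p : A[X][X]) (k : ℤ) : smithEval hx hy p * weightElement x y k ∈ T :=
    ⟨Finsupp.single k p, weightSum_single hx hy k p⟩
  have mul_mem_T (s : S)
      (h : ∀ p k, s * (smithEval (A := A) hx hy p * weightElement x y k) ∈ T) :
      ∀ t ∈ T, s * t ∈ T := by
    rintro _ ⟨P, rfl⟩
    induction P using Finsupp.induction_linear with
    | zero => simp
    | add P Q hP hQ => rw [map_add, mul_add]; exact add_mem hP hQ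
    | single k p => rw [weightSum_single]; exact h p k
  have eval_mul (q : A[X][X]) : ∀ t ∈ T, smithEval hx hy q * t ∈ T :=
    mul_mem_T _ fun p k => by rw [← mul_assoc, ← map_mul]; exact mem_T _ k
  have key (s : S) : ∀ t ∈ T, s * t ∈ T := by
    have hs : s ∈ Algebra.adjoin A {x, y, e} := hgen ▸ Algebra.mem_top
    induction hs using Algebra.adjoin_induction with
    | mem s hs =>
      rcases hs with rfl | rfl | rfl
      · refine mul_mem_T _ fun p k => ?_
        obtain ⟨p, rfl⟩ := (smithShift n f).surjective p
        obtain ⟨q, hq⟩ := exists_x_mul_weightElement (A := A) hx hy k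
        rw [← mul_assoc, (semiconjBy_x_smithEval hx hy hyx p).eq, mul_assoc, hq]
        exact eval_mul _ _ (mem_T _ _)
      · refine mul_mem_T _ fun p k => ?_
        obtain ⟨q, hq⟩ := exists_y_mul_weightElement hx hy hyx k
        rw [← mul_assoc, (semiconjBy_y_smithEval hx hy hyx p).eq, mul_assoc, hq]
        exact eval_mul _ _ (mem_T _ _)
      · simpa [smithEval_C] using eval_mul (C X)
    | algebraMap a => simpa [smithEval_C] using eval_mul (C (C a))
    | add s s' _ _ hs hs' =>
      intro t ht
      rw [add_mul]
      exact add_mem (hs t ht) (hs' t ht)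
    | mul s s' _ _ hs hs' =>
      intro t ht
      rw [mul_assoc]
      exact hs _ (hs' t ht)
  intro s
  have h1 : (1 : S) ∈ T := by simpa [weightElement] using mem_T 1 0
  exact AddMonoidHom.mem_mrange.1 (mul_one s ▸ key s 1 h1)

open Multiplicative SkewMonoidAlgebra

variable [MulSemiringAction (Multiplicative ℤ) A[X][X]]
  [SMulCommClass (Multiplicative ℤ) A A[X][X]]

include hx hy hyx in
theorem injective_of_smith_relations [IsDomain A] (hgen : Algebra.adjoin A {x, y, e} = ⊤)
    (φ : S →ₐ[A] SkewMonoidAlgebra A[X][X] (Multiplicative ℤ))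
    (hφx : φ x = single (ofAdd (-1)) 1) (hφy : φ y = single (ofAdd 1) (X + C f))
    (hφe : φ e = single 1 (C X)) (hshift : ofAdd (1 : ℤ) • (X : A[X][X]) = X + C f) :
    Function.Injective φ := by
  have hX : (X + C f : A[X][X]) ≠ 0 := X_add_C_ne_zero f
  have heval (p : A[X][X]) : φ (smithEval hx hy p) = single 1 p := by
    have h : (φ : S →+* SkewMonoidAlgebra A[X][X] (Multiplicative ℤ)).comp
        (smithEval hx hy) = singleOneRingHom := by
      refine Polynomial.ringHom_ext' (Polynomial.ringHom_ext (fun a => ?_) ?_) ?_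
      · simp [smithEval_C, singleOneRingHom]
      · simp [smithEval_C, singleOneRingHom, hφe]
      · rw [RingHom.comp_apply, smithEval_X, RingHom.coe_coe, map_mul, hφx, hφy,
          single_mul_single, ← hshift, smul_smul, ← ofAdd_add, neg_add_cancel, ofAdd_zero, one_smul,
          one_mul]
        rfl
    exact RingHom.congr_fun h p
  have hweight (k : ℤ) : ∃ c ≠ 0, φ (weightElement x y k) = single (ofAdd k) c := by
    rcases k with k | k
    · induction k with
      | zero =>
        refine ⟨1, one_ne_zero, ?_⟩
        change φ (y ^ 0) = single 1 1
        rw [pow_zero, map_one, one_def]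
      | succ k ih =>
        obtain ⟨c, hc, h⟩ := ih
        refine ⟨(X + C f) * ofAdd (1 : ℤ) • c, mul_ne_zero hX ((smul_ne_zero_iff_ne _).2 hc), ?_⟩
        change φ (y ^ (k + 1)) = _
        change φ (y ^ k) = _ at h
        rw [pow_succ', map_mul, h, hφy, single_mul_single, ← ofAdd_add]
        congr 2
        simp [add_comm]
    · refine ⟨1, one_ne_zero, ?_⟩
      change φ (x ^ (k + 1)) = _
      induction k with
      | zero => simpa using hφx
      | succ k ih =>
        rw [pow_succ', map_mul, ih, hφx, single_mul_single, ← ofAdd_add, smul_one, one_mul]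
        congr 2
        omega
  choose c hc hφ using hweight
  rw [injective_iff_map_eq_zero]
  intro s hs
  obtain ⟨P, rfl⟩ := weightSum_surjective hx hy hyx hgen s
  have hcoeff (P : ℤ →₀ A[X][X]) (k : ℤ) :
      (φ (weightSum hx hy P)).coeff (ofAdd k) = P k * c k := by
    induction P using Finsupp.induction_linear with
    | zero => simp
    | add P Q hP hQ =>
      rw [map_add, map_add, SkewMonoidAlgebra.coeff_add, Finsupp.add_apply, hP, hQ,
        Finsupp.add_apply, add_mul]
    | single j p =>
      rw [weightSum_single, map_mul, heval, hφ, single_mul_single, one_mul, one_smul,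
        coeff_single, Finsupp.single_apply, Finsupp.single_apply]
      simp only [ofAdd.injective.eq_iff]
      split_ifs with h
      · rw [h]
      · rw [zero_mul]
  suffices h : P = 0 by rw [h, map_zero]
  ext1 k
  have h := hcoeff P k
  rw [hs, SkewMonoidAlgebra.coeff_zero, Finsupp.zero_apply] at h
  exact (mul_eq_zero.1 h.symm).resolve_right (hc k)
end

section
variable {A : Type*} [CommRing A] (n : ℕ) (f : A[X])

theorem e_mul_x_sub : e A n f * x A n f - x A n f * e A n f = n • x A n f := by
  simpa [x, e] using RingQuot.mkAlgHom_rel A (SmithRel.ex (A := A) (n := n) (f := f))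

theorem e_mul_y_sub : e A n f * y A n f - y A n f * e A n f = -(n • y A n f) := by
  simpa [y, e] using RingQuot.mkAlgHom_rel A (SmithRel.ey (A := A) (n := n) (f := f))

theorem y_mul_x_sub : y A n f * x A n f - x A n f * y A n f = aeval (e A n f) f := by
  simpa [x, y, e, aeval_algHom_apply] using
    RingQuot.mkAlgHom_rel A (SmithRel.yx (A := A) (n := n) (f := f))

theorem adjoin_generators : Algebra.adjoin A {x A n f, y A n f, e A n f} = ⊤ := by
  have h : Set.range (FreeAlgebra.ι A : Fin 3 → _) = {gX A, gY A, gE A} := by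
    ext s
    simp [gX, gY, gE, Fin.exists_fin_succ, eq_comm]
  have h' := congr_arg (Subalgebra.map (RingQuot.mkAlgHom A (SmithRel A n f)))
    (FreeAlgebra.adjoin_range_ι A (Fin 3))
  rw [h, AlgHom.map_adjoin, Algebra.map_top,
    (AlgHom.range_eq_top _).2 (RingQuot.mkAlgHom_surjective A _)] at h'
  rw [Set.image_insert_eq, Set.image_insert_eq, Set.image_singleton] at h'
  exact h'

theorem isNoetherianRing_smith [IsNoetherianRing A] : IsNoetherianRing (Smith A n f) :=
  isNoetherianRing_of_smith_relations (e_mul_x_sub n f) (e_mul_y_sub n f) (y_mul_x_sub n f)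
    (adjoin_generators n f)

open MulOpposite in
theorem op_aeval {S : Type*} [Ring S] [Algebra A S] (s : S) (p : A[X]) :
    op (aeval s p) = aeval (op s) p := by
  induction p using Polynomial.induction_on' with
  | add p q hp hq => rw [map_add, map_add, op_add, hp, hq]
  | monomial k a =>
    rw [aeval_monomial, aeval_monomial, op_mul, op_pow, MulOpposite.algebraMap_apply]
    exact ((Algebra.commutes a (op s ^ k))).symm

open MulOpposite in
/-- The opposite of a Smith algebra satisfies the same relations, with `x` and `y` exchanged. -/
theorem isNoetherianRing_smith_op [IsNoetherianRing A] : IsNoetherianRing (Smith A n f)ᵐᵒᵖ := by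
  refine isNoetherianRing_of_smith_relations (A := A) (n := n) (f := f)
    (x := op (y A n f)) (y := op (x A n f)) (e := op (e A n f)) ?_ ?_ ?_ ?_
  · rw [← op_mul, ← op_mul, ← op_sub, ← op_smul, ← neg_neg (n • y A n f), ← e_mul_y_sub, neg_sub]
  · rw [← op_mul, ← op_mul, ← op_sub, ← op_smul, ← op_neg, ← e_mul_x_sub, neg_sub]
  · rw [← op_mul, ← op_mul, ← op_sub, y_mul_x_sub]
    exact op_aeval _ f
  · have h := Subalgebra.op_adjoin (R := A) {x A n f, y A n f, e A n f}
    rw [adjoin_generators, Subalgebra.op_top] at h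
    rw [h]
    congr 1
    ext s
    simp only [Set.mem_insert_iff, Set.mem_singleton_iff, Set.mem_preimage, ← unop_inj, unop_op]
    tauto

open Multiplicative SkewMonoidAlgebra in
theorem noZeroDivisors_smith [IsDomain A] : NoZeroDivisors (Smith A n f) := by
  let : MulSemiringAction (Multiplicative ℤ) A[X][X] :=
    MulSemiringAction.compHom _ (zpowersHom (A[X][X] ≃ₐ[A] A[X][X]) (smithShift n f))
  have smul_eq (p : A[X][X]) : ofAdd (1 : ℤ) • p = smithShift n f p := by
    change (smithShift n f ^ (1 : ℤ)) p = _
    rw [zpow_one]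
  have : SMulCommClass (Multiplicative ℤ) A A[X][X] := ⟨fun k a p =>
    map_smul (zpowersHom (A[X][X] ≃ₐ[A] A[X][X]) (smithShift n f) k) a p⟩
  have smul_X : ofAdd (1 : ℤ) • (X : A[X][X]) = X + C f := by rw [smul_eq, smithShift_X]
  have smul_CX : ofAdd (1 : ℤ) • (C X : A[X][X]) = C (X + C (n : A)) := by
    rw [smul_eq, smithShift_C, X_comp]
  have smul_XC' : ofAdd (-1 : ℤ) • (X + C f : A[X][X]) = X := by
    rw [← smul_X, smul_smul, ← ofAdd_add, neg_add_cancel, ofAdd_zero, one_smul]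
  have smul_CX' : ofAdd (-1 : ℤ) • (C X : A[X][X]) = C (X - C (n : A)) := by
    have h : ofAdd (1 : ℤ) • (C (X - C (n : A)) : A[X][X]) = C X := by
      rw [smul_eq, smithShift_C]; simp
    rw [← h, smul_smul, ← ofAdd_add, neg_add_cancel, ofAdd_zero, one_smul]
  have aeval_single (p : A[X]) :
      aeval (single 1 (C X) : SkewMonoidAlgebra A[X][X] (Multiplicative ℤ)) p =
        single 1 (C p) := by
    have h : (aeval (single 1 (C X)) : A[X] →ₐ[A] _).toRingHom =
        (singleOneRingHom (k := A[X][X]) (G := Multiplicative ℤ)).comp C := by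
      refine Polynomial.ringHom_ext (fun a => ?_) ?_
      · simp [singleOneRingHom]
      · simp [singleOneRingHom]
    exact RingHom.congr_fun h p
  let L := SkewMonoidAlgebra A[X][X] (Multiplicative ℤ)
  let g : Fin 3 → L := ![single (ofAdd (-1)) 1, single (ofAdd 1) (X + C f), single 1 (C X)]
  let ψ : FreeAlgebra A (Fin 3) →ₐ[A] L := FreeAlgebra.lift A g
  have hψx : ψ (gX A) = single (ofAdd (-1)) 1 := by simp [ψ, gX, g]
  have hψy : ψ (gY A) = single (ofAdd 1) (X + C f) := by simp [ψ, gY, g]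
  have hψe : ψ (gE A) = single 1 (C X) := by simp [ψ, gE, g]
  have hsub (k : Multiplicative ℤ) (p q : A[X][X]) :
      (single k (p - q) : L) = single k p - single k q := by
    rw [eq_sub_iff_add_eq, ← single_add, sub_add_cancel]
  have hψ : ∀ ⦃a b⦄, SmithRel A n f a b → ψ a = ψ b := by
    rintro _ _ (_ | _ | _)
    · rw [map_sub, map_mul, map_mul, map_nsmul, hψx, hψe, single_mul_single, single_mul_single,
        smul_CX', one_smul, one_mul, mul_one, one_mul, mul_one, ← hsub, smul_single]
      congr 1
      simp [nsmul_eq_mul]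
    · rw [map_sub, map_mul, map_mul, map_neg, map_nsmul, hψy, hψe, single_mul_single,
        single_mul_single, smul_CX, one_smul, one_mul, mul_one, ← hsub, smul_single,
        ← single_neg]
      congr 1
      simp [nsmul_eq_mul]
      ring
    · rw [map_sub, map_mul, map_mul, hψx, hψy, ← aeval_algHom_apply, hψe, single_mul_single,
        single_mul_single, smul_one, smul_XC', mul_one, one_mul, ← ofAdd_add, ← ofAdd_add,
        add_neg_cancel, neg_add_cancel, ofAdd_zero, ← hsub, add_sub_cancel_left]
      exact (aeval_single f).symm
  let φ : Smith A n f →ₐ[A] L := RingQuot.liftAlgHom A ⟨ψ, hψ⟩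
  have hφ (a : FreeAlgebra A (Fin 3)) : φ (RingQuot.mkAlgHom A (SmithRel A n f) a) = ψ a :=
    RingQuot.liftAlgHom_mkAlgHom_apply A ψ hψ a
  exact (injective_of_smith_relations (e_mul_x_sub n f) (e_mul_y_sub n f) (y_mul_x_sub n f)
    (adjoin_generators n f) φ ((hφ _).trans hψx) ((hφ _).trans hψy) ((hφ _).trans hψe)
    smul_X).noZeroDivisors φ (map_zero φ) (map_mul φ)
end

/-- If `A` is moreover noetherian, then the Smith algebra `S(A,f,n)`
has no zero divisors and is left and right noetherian. -/
theorem stmt_2 {A : Type*} [CommRing A] [IsDomain A] [Algebra ℂ A] [IsNoetherianRing A]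
    (n : ℕ) (hn : 0 < n) (f : Polynomial A) :
    NoZeroDivisors (Smith A n f) ∧
    IsNoetherianRing (Smith A n f) ∧
    IsNoetherianRing (Smith A n f)ᵐᵒᵖ :=
  ⟨noZeroDivisors_smith n f, isNoetherianRing_smith n f, isNoetherianRing_smith_op n f⟩

end SmithAlgebraStmt
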